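/- The Petersen graph is (K1 ∪ K_{1,3})-free and (K1 ∪ P6)-free. -/

import Mathlib

/-- A graph `G` is `F`-free if it contains no induced subgraph isomorphic to `F`,
i.e. there is no graph embedding of `F` into `G`. -/
def InducedFree {W V : Type*} (H : SimpleGraph W) (G : SimpleGraph V) : Prop :=
  ¬ Nonempty (H ↪g G)

/-- `K1 ∪ K_{1,3}`: an isolated vertex `0` together with a claw with center `1` and
leaves `2`, `3`, `4`. -/
def K1K13 : SimpleGraph (Fin 5) := SimpleGraph.fromEdgeSet {s(1, 2), s(1, 3), s(1, 4)}

/-- `K1 ∪ P6`: an isolated vertex `0` together with an induced path `1 - 2 - 3 - 4 - 5 - 6`. -/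
def K1P6 : SimpleGraph (Fin 7) :=
  SimpleGraph.fromEdgeSet {s(1, 2), s(2, 3), s(3, 4), s(4, 5), s(5, 6)}

/-- The Petersen graph: vertices are the 2-element subsets of a 5-element set, with two
vertices adjacent if and only if the corresponding subsets are disjoint. -/
def petersen : SimpleGraph {s : Finset (Fin 5) // s.card = 2} :=
  SimpleGraph.fromRel (fun a b => Disjoint a.1 b.1)

instance : DecidableRel petersen.Adj := fun a b =>
  inferInstanceAs (Decidable (a ≠ b ∧ (Disjoint a.1 b.1 ∨ Disjoint b.1 a.1)))

/-- Every vertex of the Petersen graph has exactly `7` non-neighbours, itself included. -/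
theorem petersen_card_filter_not_adj :
    ∀ v, (Finset.univ.filter fun x => ¬ petersen.Adj v x).card = 7 := by
  decide +kernel

/-- The non-neighbours of a vertex `v` of the Petersen graph, other than `v`, induce a
`2`-regular graph. -/
theorem petersen_card_filter_adj_not_adj :
    ∀ v a, v ≠ a → ¬ petersen.Adj v a →
      (Finset.univ.filter fun x => petersen.Adj a x ∧ ¬ petersen.Adj v x).card = 2 := by
  decide +kernel

theorem petersen_inducedFree_K1K13 : InducedFree K1K13 petersen := by
  rintro ⟨f⟩
  have hcard := petersen_card_filter_adj_not_adj (f 0) (f 1) (f.injective.ne (by decide))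
    (by rw [f.map_adj_iff]; simp [K1K13])
  have hsub : ({2, 3, 4} : Finset (Fin 5)).map f.toEmbedding ⊆
      Finset.univ.filter fun x => petersen.Adj (f 1) x ∧ ¬ petersen.Adj (f 0) x := by
    intro x hx
    obtain ⟨i, hi, rfl⟩ := Finset.mem_map.mp hx
    rw [Finset.mem_filter]
    refine ⟨Finset.mem_univ _, ?_⟩
    change petersen.Adj (f 1) (f i) ∧ ¬ petersen.Adj (f 0) (f i)
    rw [f.map_adj_iff, f.map_adj_iff]
    fin_cases i <;> simp_all [K1K13]
  have hle := Finset.card_le_card hsub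
  rw [hcard, Finset.card_map] at hle
  exact absurd hle (by decide)

theorem petersen_inducedFree_K1P6 : InducedFree K1P6 petersen := by
  rintro ⟨f⟩
  have hzero (i : Fin 7) : ¬ petersen.Adj (f 0) (f i) := by
    rw [f.map_adj_iff]
    fin_cases i <;> simp [K1P6]
  have hrange : Finset.univ.map f.toEmbedding =
      Finset.univ.filter fun x => ¬ petersen.Adj (f 0) x := by
    refine Finset.eq_of_subset_of_card_le (fun x hx => ?_) ?_
    · obtain ⟨i, -, rfl⟩ := Finset.mem_map.mp hx
      exact Finset.mem_filter.mpr ⟨Finset.mem_univ _, hzero i⟩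
    · rw [petersen_card_filter_not_adj, Finset.card_map, Finset.card_univ, Fintype.card_fin]
  have hcard := petersen_card_filter_adj_not_adj (f 0) (f 1) (f.injective.ne (by decide))
    (hzero 1)
  have hsub : (Finset.univ.filter fun x => petersen.Adj (f 1) x ∧ ¬ petersen.Adj (f 0) x) ⊆
      {f 2} := by
    intro x hx
    obtain ⟨-, hadj, hnot⟩ := Finset.mem_filter.mp hx
    have hmem : x ∈ Finset.univ.map f.toEmbedding :=
      hrange ▸ Finset.mem_filter.mpr ⟨Finset.mem_univ _, hnot⟩
    obtain ⟨i, -, rfl⟩ := Finset.mem_map.mp hmem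
    replace hadj : petersen.Adj (f 1) (f i) := hadj
    rw [f.map_adj_iff] at hadj
    obtain rfl : i = 2 := by
      fin_cases i <;> simp_all [K1P6]
    exact Finset.mem_singleton_self _
  have hle := Finset.card_le_card hsub
  rw [hcard, Finset.card_singleton] at hle
  exact absurd hle (by decide)

/-- The Petersen graph is `(K1 ∪ K_{1,3})`-free and `(K1 ∪ P6)`-free. -/
theorem stmt_11 : InducedFree K1K13 petersen ∧ InducedFree K1P6 petersen := by
  exact ⟨petersen_inducedFree_K1K13, petersen_inducedFree_K1P6⟩
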